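/- Let c be a real number. With J₁ = x₂p₃ − x₃p₂, J₂ = x₃p₁ − x₁p₃, J₃ = x₁p₂ − x₂p₁, define the Goryachev integrals H = J₁² + J₂² + (4/3)J₃² − c x₁/(2 x₃^{2/3}) and K = J₃(J₁² + J₂² + (8/9)J₃²) + c(3J₁x₃ − 2J₃x₁)/(4 x₃^{2/3}). Then {H, K}_S = 0 at every point of the constraint surface T*S² (where x₁²+x₂²+x₃² = 1 and x₁p₁+x₂p₂+x₃p₃ = 0) with x₃ > 0. -/

import Mathlib

noncomputable section

/-- Phase space T*ℝ³ = ℝ³ × ℝ³ with coordinates (x, p). -/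
abbrev Phase : Type := (Fin 3 → ℝ) × (Fin 3 → ℝ)

/-- Canonical Poisson bracket on ℝ³ × ℝ³:
{f,g} = Σᵢ (∂f/∂xᵢ ∂g/∂pᵢ − ∂f/∂pᵢ ∂g/∂xᵢ). -/
noncomputable def pb (f g : Phase → ℝ) (z : Phase) : ℝ :=
  ∑ i : Fin 3,
    (fderiv ℝ f z (Pi.single i 1, 0) * fderiv ℝ g z (0, Pi.single i 1) -
     fderiv ℝ f z (0, Pi.single i 1) * fderiv ℝ g z (Pi.single i 1, 0))

/-- Dirac bracket associated with constraints F₁, F₂: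
{f,g}_D = {f,g} − ({F₁,f}{F₂,g} − {F₁,g}{F₂,f})/{F₁,F₂}. -/
noncomputable def dirac (F₁ F₂ f g : Phase → ℝ) (z : Phase) : ℝ :=
  pb f g z - (pb F₁ f z * pb F₂ g z - pb F₁ g z * pb F₂ f z) / pb F₁ F₂ z
/-- Sphere constraint F₁ = x₁² + x₂² + x₃² − 1. -/
def sphereF₁ : Phase → ℝ := fun z => z.1 0 ^ 2 + z.1 1 ^ 2 + z.1 2 ^ 2 - 1

/-- Sphere constraint F₂ = x₁p₁ + x₂p₂ + x₃p₃. -/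
def sphereF₂ : Phase → ℝ := fun z => z.1 0 * z.2 0 + z.1 1 * z.2 1 + z.1 2 * z.2 2

/-- Sphere Dirac bracket {·,·}_S. -/
noncomputable def diracS (f g : Phase → ℝ) (z : Phase) : ℝ :=
  dirac sphereF₁ sphereF₂ f g z

/-- Angular momentum J₁ = x₂p₃ − x₃p₂. -/
noncomputable def J1 : Phase → ℝ := fun z => z.1 1 * z.2 2 - z.1 2 * z.2 1
/-- Angular momentum J₂ = x₃p₁ − x₁p₃. -/
noncomputable def J2 : Phase → ℝ := fun z => z.1 2 * z.2 0 - z.1 0 * z.2 2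
/-- Angular momentum J₃ = x₁p₂ − x₂p₁. -/
noncomputable def J3 : Phase → ℝ := fun z => z.1 0 * z.2 1 - z.1 1 * z.2 0

lemma hasFDerivAt_position (i : Fin 3) (z : Phase) :
    HasFDerivAt (fun w : Phase => w.1 i)
      ((ContinuousLinearMap.proj (R := ℝ) (φ := fun _ : Fin 3 => ℝ) i).comp
        (ContinuousLinearMap.fst ℝ (Fin 3 → ℝ) (Fin 3 → ℝ))) z :=
  ((ContinuousLinearMap.proj (R := ℝ) (φ := fun _ : Fin 3 => ℝ) i).comp
    (ContinuousLinearMap.fst ℝ (Fin 3 → ℝ) (Fin 3 → ℝ))).hasFDerivAt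

lemma hasFDerivAt_momentum (i : Fin 3) (z : Phase) :
    HasFDerivAt (fun w : Phase => w.2 i)
      ((ContinuousLinearMap.proj (R := ℝ) (φ := fun _ : Fin 3 => ℝ) i).comp
        (ContinuousLinearMap.snd ℝ (Fin 3 → ℝ) (Fin 3 → ℝ))) z :=
  ((ContinuousLinearMap.proj (R := ℝ) (φ := fun _ : Fin 3 => ℝ) i).comp
    (ContinuousLinearMap.snd ℝ (Fin 3 → ℝ) (Fin 3 → ℝ))).hasFDerivAt

/-- The differential of `x₃ ^ (-2/3)`, written as an inverse, on the half-space `x₃ > 0`. -/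
lemma hasFDerivAt_inv_rpow_two_thirds (z : Phase) (hz : 0 < z.1 2) :
    HasFDerivAt (fun w : Phase => (w.1 2 ^ ((2 : ℝ) / 3))⁻¹)
      ((-(2 / 3) * (z.1 2 ^ ((2 : ℝ) / 3))⁻¹ / z.1 2) •
        (ContinuousLinearMap.proj (R := ℝ) (φ := fun _ : Fin 3 => ℝ) 2).comp
          (ContinuousLinearMap.fst ℝ (Fin 3 → ℝ) (Fin 3 → ℝ))) z := by
  have hr : HasDerivAt (fun t : ℝ => (t ^ ((2 : ℝ) / 3))⁻¹)
      (-(2 / 3) * (z.1 2 ^ ((2 : ℝ) / 3))⁻¹ / z.1 2) (z.1 2) := by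
    have hpos : z.1 2 ^ ((2 : ℝ) / 3) ≠ 0 := (Real.rpow_pos_of_pos hz _).ne'
    refine ((Real.hasDerivAt_rpow_const (p := (2 : ℝ) / 3)
      (Or.inl hz.ne')).fun_inv hpos).congr_deriv ?_
    rw [Real.rpow_sub_one hz.ne']
    field_simp
  exact hr.comp_hasFDerivAt (h₂ := fun t : ℝ => (t ^ ((2 : ℝ) / 3))⁻¹) z (hasFDerivAt_position 2 z)

/-- the Goryachev integrals H = J₁² + J₂² + (4/3)J₃² − cx₁/(2x₃^{2/3})
and K = J₃(J₁² + J₂² + (8/9)J₃²) + c(3J₁x₃ − 2J₃x₁)/(4x₃^{2/3}) are in involution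
with respect to the sphere Dirac bracket on T*S² where x₃ > 0. -/
theorem goryachev_sphere_involution
    (c : ℝ) (z : Phase)
    (h1 : z.1 0 ^ 2 + z.1 1 ^ 2 + z.1 2 ^ 2 = 1)
    (h2 : z.1 0 * z.2 0 + z.1 1 * z.2 1 + z.1 2 * z.2 2 = 0)
    (hx3 : 0 < z.1 2) :
    diracS
      (fun w => J1 w ^ 2 + J2 w ^ 2 + (4 / 3 : ℝ) * J3 w ^ 2 -
        c * w.1 0 / (2 * w.1 2 ^ ((2 : ℝ) / 3)))
      (fun w => J3 w * (J1 w ^ 2 + J2 w ^ 2 + (8 / 9 : ℝ) * J3 w ^ 2) +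
        c * (3 * J1 w * w.1 2 - 2 * J3 w * w.1 0) / (4 * w.1 2 ^ ((2 : ℝ) / 3))) z
      = 0 := by
  have hx := fun i => hasFDerivAt_position i z
  have hp := fun i => hasFDerivAt_momentum i z
  have hu := hasFDerivAt_inv_rpow_two_thirds z hx3
  have hJ1 : HasFDerivAt J1 _ z := ((hx 1).fun_mul (hp 2)).fun_sub ((hx 2).fun_mul (hp 1))
  have hJ2 : HasFDerivAt J2 _ z := ((hx 2).fun_mul (hp 0)).fun_sub ((hx 0).fun_mul (hp 2))
  have hJ3 : HasFDerivAt J3 _ z := ((hx 0).fun_mul (hp 1)).fun_sub ((hx 1).fun_mul (hp 0))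
  have hF₁ : HasFDerivAt sphereF₁ _ z :=
    ((((hx 0).pow 2).fun_add ((hx 1).pow 2)).fun_add ((hx 2).pow 2)).sub_const 1
  have hH := ((((hJ1.pow 2).fun_add (hJ2.pow 2)).fun_add
    ((hJ3.pow 2).const_mul (4 / 3 : ℝ))).fun_sub
      (((hx 0).const_mul (c / 2)).fun_mul hu))
  have hK := (hJ3.fun_mul (((hJ1.pow 2).fun_add (hJ2.pow 2)).fun_add
    ((hJ3.pow 2).const_mul (8 / 9 : ℝ)))).fun_add
      (((((hJ1.const_mul 3).fun_mul (hx 2)).fun_sub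
        ((hJ3.const_mul 2).fun_mul (hx 0))).const_mul (c / 4)).fun_mul hu)
  have eH : (fun w : Phase => J1 w ^ 2 + J2 w ^ 2 + (4 / 3 : ℝ) * J3 w ^ 2 -
        c * w.1 0 / (2 * w.1 2 ^ ((2 : ℝ) / 3))) =
      fun w => J1 w ^ 2 + J2 w ^ 2 + (4 / 3 : ℝ) * J3 w ^ 2 -
        c / 2 * w.1 0 * (w.1 2 ^ ((2 : ℝ) / 3))⁻¹ := by
    funext w
    simp only [div_eq_mul_inv, mul_inv]
    ring
  have eK : (fun w : Phase => J3 w * (J1 w ^ 2 + J2 w ^ 2 + (8 / 9 : ℝ) * J3 w ^ 2) +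
        c * (3 * J1 w * w.1 2 - 2 * J3 w * w.1 0) / (4 * w.1 2 ^ ((2 : ℝ) / 3))) =
      fun w => J3 w * (J1 w ^ 2 + J2 w ^ 2 + (8 / 9 : ℝ) * J3 w ^ 2) +
        c / 4 * (3 * J1 w * w.1 2 - 2 * J3 w * w.1 0) * (w.1 2 ^ ((2 : ℝ) / 3))⁻¹ := by
    funext w
    simp only [div_eq_mul_inv, mul_inv]
    ring
  rw [eH, eK, diracS, dirac]
  have hx3' := hx3.ne'
  generalize (z.1 2 ^ ((2 : ℝ) / 3))⁻¹ = u at hu hH hK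
  have zH : pb sphereF₁ (fun w => J1 w ^ 2 + J2 w ^ 2 + (4 / 3 : ℝ) * J3 w ^ 2 -
        c / 2 * w.1 0 * (w.1 2 ^ ((2 : ℝ) / 3))⁻¹) z = 0 := by
    simp only [pb, Fin.sum_univ_three, hF₁.fderiv, hH.fderiv]
    simp [J1, J2, J3]
    ring
  have zK : pb sphereF₁ (fun w => J3 w * (J1 w ^ 2 + J2 w ^ 2 + (8 / 9 : ℝ) * J3 w ^ 2) +
        c / 4 * (3 * J1 w * w.1 2 - 2 * J3 w * w.1 0) * (w.1 2 ^ ((2 : ℝ) / 3))⁻¹) z = 0 := by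
    simp only [pb, Fin.sum_univ_three, hF₁.fderiv, hK.fderiv]
    simp [J1, J2, J3]
    ring
  rw [zH, zK]
  simp only [zero_mul, sub_zero, zero_div]
  simp only [pb, Fin.sum_univ_three, hH.fderiv, hK.fderiv]
  simp [J1, J2, J3]
  field_simp
  ring
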